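/- Suppose u₀ is an initial world in a Kripke model N with reflexive and transitive accessibility relation, and suppose that for every n there is a ratchet of length n at u₀. Then every propositional modal formula valid at u₀ (meaning every uniform substitution instance of it is true at u₀ in N) is provable in the modal logic Grz.3. -/

import Mathlib

namespace GrzPaper

/-- Propositional modal formulas, built from variables, falsum, implication and box. -/
inductive Formula : Type
  | var : ℕ → Formula
  | fls : Formula
  | impl : Formula → Formula → Formula
  | box : Formula → Formula
deriving DecidableEq

namespace Formula

def neg (φ : Formula) : Formula := impl φ fls
def tru : Formula := neg fls
def disj (φ ψ : Formula) : Formula := impl (neg φ) ψ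
def conj (φ ψ : Formula) : Formula := neg (impl φ (neg ψ))
def dia (φ : Formula) : Formula := neg (box (neg φ))

/-- Uniform substitution. -/
def subst (σ : ℕ → Formula) : Formula → Formula
  | var n => σ n
  | fls => fls
  | impl a b => impl (subst σ a) (subst σ b)
  | box a => box (subst σ a)

/-- Propositional (Boolean) evaluation, treating variables and boxed formulas as atoms. -/
def evalProp (v : Formula → Bool) : Formula → Bool
  | var n => v (var n)
  | fls => false
  | impl a b => !(evalProp v a) || evalProp v b
  | box a => v (box a)

/-- A propositional tautology: true under every Boolean valuation of the atoms
(variables and boxed subformulas). -/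
def Tautology (φ : Formula) : Prop := ∀ v, evalProp v φ = true

end Formula

open Formula

/-- A normal modal logic: contains all propositional tautologies and all instances of K,
closed under modus ponens, necessitation and uniform substitution. -/
structure IsNormalLogic (L : Set Formula) : Prop where
  taut : ∀ φ, Tautology φ → φ ∈ L
  axK : ∀ φ ψ, impl (box (impl φ ψ)) (impl (box φ) (box ψ)) ∈ L
  mp : ∀ φ ψ, impl φ ψ ∈ L → φ ∈ L → ψ ∈ L
  nec : ∀ φ, φ ∈ L → box φ ∈ L
  subst : ∀ φ σ, φ ∈ L → φ.subst σ ∈ L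

/-- The normal modal logic generated by a set of axioms: the smallest normal modal
logic containing them. -/
def Generated (Ax : Set Formula) : Set Formula :=
  ⋂₀ {L | IsNormalLogic L ∧ Ax ⊆ L}

def pv : Formula := var 0
def qv : Formula := var 1

def axT : Formula := impl (box pv) pv
def axFour : Formula := impl (box pv) (box (box pv))
def axGrz : Formula := impl (box (impl (box (impl pv (box pv))) pv)) pv
def axPoint2 : Formula := impl (dia (box pv)) (box (dia pv))
def axPoint3 : Formula := disj (box (impl (box pv) qv)) (box (impl (box qv) pv))

/-- penultimate(φ) : φ ∧ ◇¬φ ∧ □(¬φ → □¬φ). -/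
def penultimate (φ : Formula) : Formula :=
  conj φ (conj (dia (neg φ)) (box (impl (neg φ) (box (neg φ)))))

/-- contingent(φ) : ◇φ ∧ ◇¬φ. -/
def contingent (φ : Formula) : Formula := conj (dia φ) (dia (neg φ))

/-- The axiom Grz* : contingent(p) → ◇(penultimate(p) ∨ penultimate(¬p)). -/
def axGrzStar : Formula :=
  impl (contingent pv) (dia (disj (penultimate pv) (penultimate (neg pv))))

def Grz : Set Formula := Generated {axGrz}
def GrzStarLogic : Set Formula := Generated {axGrzStar}
def S4GrzStar : Set Formula := Generated {axT, axFour, axGrzStar}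
def Grz2 : Set Formula := Generated {axGrz, axPoint2}
def Grz3 : Set Formula := Generated {axGrz, axPoint3}
def KLogic : Set Formula := Generated ∅

/-- A Kripke model: an accessibility relation together with a valuation. -/
structure KripkeModel (W : Type) where
  rel : W → W → Prop
  val : ℕ → W → Prop

/-- Satisfaction of a modal formula at a world of a Kripke model. -/
def Satisfies {W : Type} (M : KripkeModel W) : W → Formula → Prop
  | w, .var n => M.val n w
  | _, .fls => False
  | w, .impl a b => Satisfies M w a → Satisfies M w b
  | w, .box a => ∀ v, M.rel w v → Satisfies M v a

/-- Validity of a formula on a Kripke frame. -/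
def ValidOnFrame (W : Type) (R : W → W → Prop) (φ : Formula) : Prop :=
  ∀ (val : ℕ → W → Prop) (w : W), Satisfies ⟨R, val⟩ w φ

/-- A model labeling of (M,w₀) for (N,u₀): a substitution σ such that every formula is
true at (M,w₀) iff its σ-instance is true at (N,u₀). -/
def ModelLabeling {W U : Type} (M : KripkeModel W) (w0 : W) (N : KripkeModel U) (u0 : U)
    (σ : ℕ → Formula) : Prop :=
  ∀ φ : Formula, Satisfies M w0 φ ↔ Satisfies N u0 (φ.subst σ)

/-- A frame labeling of the frame (W,R) with initial node w₀ for the pointed model (N,u₀). -/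
def FrameLabeling {W U : Type} (R : W → W → Prop) (w0 : W) (N : KripkeModel U) (u0 : U)
    (Φ : W → Formula) : Prop :=
  Satisfies N u0 (Φ w0) ∧
  (∀ u, N.rel u0 u → ∀ w, Satisfies N u (Φ w) →
    ∀ w', (Satisfies N u (dia (Φ w')) ↔ R w w')) ∧
  (∀ u, N.rel u0 u → ∃! w, Satisfies N u (Φ w))

def bigOr : List Formula → Formula
  | [] => fls
  | φ :: l => disj φ (bigOr l)

def bigAnd : List Formula → Formula
  | [] => tru
  | φ :: l => conj φ (bigAnd l)

open Classical in
/-- The disjunction ⋁ {Φ w : P w}. -/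
noncomputable def labelFormula {W : Type} [Fintype W] (Φ : W → Formula) (P : W → Prop) :
    Formula :=
  bigOr ((Finset.univ.filter P).toList.map Φ)

/-- Θ_A : the formula asserting that the button pattern is exactly A. -/
noncomputable def Theta {n : ℕ} (b : Fin n → Formula) (A : Finset (Fin n)) : Formula :=
  bigAnd ((Finset.univ : Finset (Fin n)).toList.map
    (fun i => if i ∈ A then box (b i) else neg (box (b i))))

/-- b₀,…,b_{n−1} are independent buttons at u₀: none is pushed (necessary) at u₀, and
necessarily, whenever the button pattern is exactly A, every larger pattern is possible. -/
def IndependentButtons {U : Type} (N : KripkeModel U) (u0 : U) {n : ℕ}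
    (b : Fin n → Formula) : Prop :=
  (∀ i, ¬ Satisfies N u0 (box (b i))) ∧
  ∀ A : Finset (Fin n), ∀ u, N.rel u0 u → Satisfies N u (Theta b A) →
    ∀ A' : Finset (Fin n), A ⊆ A' → Satisfies N u (dia (Theta b A'))

/-- r₀,…,r_{n−1} form a ratchet of length n at u₀. -/
def Ratchet {U : Type} (N : KripkeModel U) (u0 : U) {n : ℕ} (r : Fin n → Formula) : Prop :=
  (∀ i : Fin n, (i.val = 0 → Satisfies N u0 (box (r i))) ∧
      (0 < i.val → ¬ Satisfies N u0 (box (r i)))) ∧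
  (∀ u, N.rel u0 u → ∀ i j : Fin n, i < j →
      Satisfies N u (box (r j)) → Satisfies N u (box (r i))) ∧
  (∀ u, N.rel u0 u → ∀ i : Fin n, 0 < i.val →
      (∀ j : Fin n, Satisfies N u (box (r j)) ↔ j < i) →
        ∃ v, N.rel u v ∧ ∀ j : Fin n, Satisfies N v (box (r j)) ↔ j ≤ i)

/-- A (finite) tree order: a partial order with a least element in which the set of
predecessors of every element is linearly ordered. -/
def IsTreeOrder {W : Type} (R : W → W → Prop) : Prop :=
  IsPartialOrder W R ∧ (∃ r, ∀ x, R r x) ∧ ∀ x a b, R a x → R b x → R a b ∨ R b a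

/-- A baled tree order: a partial order with a greatest element t whose removal
leaves a tree. -/
def IsBaledTreeOrder {W : Type} (R : W → W → Prop) : Prop :=
  IsPartialOrder W R ∧ ∃ t : W, (∀ x, R x t) ∧
    (∃ r, r ≠ t ∧ ∀ x, x ≠ t → R r x) ∧
    (∀ x a b, x ≠ t → R a x → R b x → R a b ∨ R b a)

/-- Height of a node: the number of its strict predecessors. -/
noncomputable def heightOf {W : Type} (R : W → W → Prop) (x : W) : ℕ :=
  Nat.card {y : W // R y x ∧ y ≠ x}

/-- y is an immediate successor of x. -/
def ImmSucc {W : Type} (R : W → W → Prop) (x y : W) : Prop :=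
  R x y ∧ x ≠ y ∧ ∀ z, R x z → R z y → z = x ∨ z = y

def IsMaximal {W : Type} (R : W → W → Prop) (x : W) : Prop := ∀ z, R x z → z = x

/-- A regular finite tree: all maximal elements have the same height, and any two
elements of the same height have the same number of immediate successors. -/
def IsRegularTree {W : Type} (R : W → W → Prop) : Prop :=
  IsTreeOrder R ∧
  (∀ x y, IsMaximal R x → IsMaximal R y → heightOf R x = heightOf R y) ∧
  (∀ x y, heightOf R x = heightOf R y →
    Nat.card {z : W // ImmSucc R x z} = Nat.card {z : W // ImmSucc R y z})


section Generated

variable {L : Set Formula}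

theorem generated_isNormalLogic (Ax : Set Formula) : IsNormalLogic (Generated Ax) where
  taut φ hφ := fun _ hL => hL.1.taut φ hφ
  axK φ ψ := fun _ hL => hL.1.axK φ ψ
  mp φ ψ h h' := fun L hL => hL.1.mp φ ψ (h L hL) (h' L hL)
  nec φ h := fun L hL => hL.1.nec φ (h L hL)
  subst φ σ h := fun L hL => hL.1.subst φ σ (h L hL)

theorem subset_generated (Ax : Set Formula) : Ax ⊆ Generated Ax :=
  fun _ hφ _ hL => hL.2 hφ

/-- A set of formulas containing `L` and closed under modus ponens. -/
structure IsTheory (L T : Set Formula) : Prop where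
  sub : L ⊆ T
  mp : ∀ {φ ψ}, impl φ ψ ∈ T → φ ∈ T → ψ ∈ T

theorem IsNormalLogic.isTheory (hL : IsNormalLogic L) : IsTheory L L :=
  ⟨subset_rfl, fun h h' => hL.mp _ _ h h'⟩

/-- The theory obtained by adjoining a formula. -/
theorem IsTheory.adjoin (hL : IsNormalLogic L) {T : Set Formula} (hT : IsTheory L T)
    (φ : Formula) : IsTheory L {ψ | impl φ ψ ∈ T} where
  sub ψ hψ := hT.mp (hT.sub (hL.taut (impl ψ (impl φ ψ)) fun v => by
    simp only [evalProp]; cases evalProp v φ <;> cases evalProp v ψ <;> rfl)) (hT.sub hψ)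
  mp {α β} h h' := hT.mp (hT.mp (hT.sub (hL.taut
    (impl (impl φ (impl α β)) (impl (impl φ α) (impl φ β))) fun v => by
      simp only [evalProp]
      cases evalProp v φ <;> cases evalProp v α <;> cases evalProp v β <;> rfl)) h) h'

/-- The theory of formulas necessary in a given theory. -/
theorem IsTheory.unbox (hL : IsNormalLogic L) {T : Set Formula} (hT : IsTheory L T) :
    IsTheory L {ψ | box ψ ∈ T} where
  sub ψ hψ := hT.sub (hL.nec ψ hψ)
  mp {α β} h h' := hT.mp (hT.mp (hT.sub (hL.axK α β)) h) h'

/-- A world of the canonical model of `L`: a maximal consistent theory. -/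
structure World (L : Set Formula) where
  carrier : Set Formula
  isTheory : IsTheory L carrier
  fls_notMem : fls ∉ carrier
  complete : ∀ φ, φ ∈ carrier ∨ neg φ ∈ carrier

/-- Lindenbaum's lemma. -/
theorem IsTheory.exists_world (hL : IsNormalLogic L) {T : Set Formula} (hT : IsTheory L T)
    {φ : Formula} (hφ : φ ∉ T) : ∃ x : World L, T ⊆ x.carrier ∧ φ ∉ x.carrier := by
  obtain ⟨M, hTM, hM⟩ := zorn_subset_nonempty {S | IsTheory L S ∧ φ ∉ S} (by
    intro c hc hchain ⟨S₀, hS₀⟩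
    refine ⟨⋃₀ c, ⟨⟨fun ψ hψ => ⟨S₀, hS₀, (hc hS₀).1.sub hψ⟩, ?_⟩, ?_⟩,
      fun S hS => Set.subset_sUnion_of_mem hS⟩
    · rintro α β ⟨S₁, hS₁, h₁⟩ ⟨S₂, hS₂, h₂⟩
      rcases hchain.total hS₁ hS₂ with h | h
      · exact ⟨S₂, hS₂, (hc hS₂).1.mp (h h₁) h₂⟩
      · exact ⟨S₁, hS₁, (hc hS₁).1.mp h₁ (h h₂)⟩
    · rintro ⟨S, hS, h⟩
      exact (hc hS).2 h) T ⟨hT, hφ⟩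
  obtain ⟨hMT, hφM⟩ := hM.prop
  have key : ∀ α, α ∉ M → impl α φ ∈ M := by
    intro α hα
    by_contra hcon
    refine hα (hM.le_of_ge (y := {ψ | impl α ψ ∈ M}) ⟨hMT.adjoin hL α, hcon⟩ ?_ ?_)
    · intro ψ hψ
      exact hMT.mp (hMT.sub (hL.taut (impl ψ (impl α ψ)) fun v => by
        simp only [evalProp]; cases evalProp v α <;> cases evalProp v ψ <;> rfl)) hψ
    · exact hMT.sub (hL.taut (impl α α) fun v => by
        simp only [evalProp]; cases evalProp v α <;> rfl)
  refine ⟨⟨M, hMT, fun h => hφM ?_, fun α => ?_⟩, hTM, hφM⟩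
  · exact hMT.mp (hMT.sub (hL.taut (impl fls φ) fun v => by simp [evalProp])) h
  · by_contra! hcon
    refine hφM (hMT.mp (hMT.mp (hMT.sub (hL.taut
      (impl (impl α φ) (impl (impl (neg α) φ) φ)) fun v => ?_)) (key _ hcon.1)) (key _ hcon.2))
    simp only [evalProp, neg]
    cases evalProp v α <;> cases evalProp v φ <;> rfl

namespace World

variable (x : World L)

theorem impl_mem (hL : IsNormalLogic L) {φ ψ : Formula} :
    impl φ ψ ∈ x.carrier ↔ (φ ∈ x.carrier → ψ ∈ x.carrier) := by
  refine ⟨fun h h' => x.isTheory.mp h h', fun h => ?_⟩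
  by_cases hφ : φ ∈ x.carrier
  · exact x.isTheory.mp (x.isTheory.sub (hL.taut (impl ψ (impl φ ψ)) fun v => by
      simp only [evalProp]; cases evalProp v φ <;> cases evalProp v ψ <;> rfl)) (h hφ)
  · exact x.isTheory.mp (x.isTheory.sub (hL.taut (impl (neg φ) (impl φ ψ)) fun v => by
      simp only [evalProp, neg]; cases evalProp v φ <;> cases evalProp v ψ <;> rfl))
      ((x.complete φ).resolve_left hφ)

/-- The accessibility relation of the canonical model. -/
def Rel (x y : World L) : Prop := ∀ φ, box φ ∈ x.carrier → φ ∈ y.carrier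

theorem box_mem (hL : IsNormalLogic L) {φ : Formula} :
    box φ ∈ x.carrier ↔ ∀ y, Rel x y → φ ∈ y.carrier := by
  refine ⟨fun h y hy => hy φ h, fun h => ?_⟩
  by_contra hφ
  obtain ⟨y, hxy, hy⟩ := (x.isTheory.unbox hL).exists_world hL (φ := φ) hφ
  exact hy (h y fun ψ hψ => hxy hψ)

end World

end Generated

section Grz3

theorem grz3_isNormalLogic : IsNormalLogic Grz3 := generated_isNormalLogic _

namespace World

variable {x y z : World Grz3}

/-- In the canonical model, below every failure of `φ` there is one after which `φ`, once true,
stays true. -/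
theorem exists_rel_notMem_of_notMem {φ : Formula} (hφ : φ ∉ x.carrier) :
    ∃ y, Rel x y ∧ φ ∉ y.carrier ∧ box (impl φ (box φ)) ∈ y.carrier := by
  have h : impl (box (impl (box (impl φ (box φ))) φ)) φ ∈ Grz3 :=
    grz3_isNormalLogic.subst axGrz (fun _ => φ) (subset_generated _ (by simp))
  have h' := mt ((x.impl_mem grz3_isNormalLogic).1 (x.isTheory.sub h)) hφ
  rw [box_mem _ grz3_isNormalLogic] at h'
  push Not at h'
  obtain ⟨y, hxy, hy⟩ := h'
  rw [impl_mem _ grz3_isNormalLogic] at hy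
  push Not at hy
  exact ⟨y, hxy, hy.2, hy.1⟩

theorem rel_refl (x : World Grz3) : Rel x x := by
  intro φ hφ
  by_contra h
  obtain ⟨y, hxy, hy, -⟩ := exists_rel_notMem_of_notMem h
  exact hy (hxy φ hφ)

theorem box_box_mem {φ : Formula} (h : box φ ∈ x.carrier) : box (box φ) ∈ x.carrier := by
  have hL := grz3_isNormalLogic
  by_contra hcon
  -- Apply the Grzegorczyk axiom to `φ ∧ (□φ → □□φ)`.
  have hmem : ∀ w : World Grz3, conj φ (impl (box φ) (box (box φ))) ∈ w.carrier ↔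
      φ ∈ w.carrier ∧ (box φ ∈ w.carrier → box (box φ) ∈ w.carrier) := by
    intro w
    simp only [conj, neg, impl_mem _ hL, w.fls_notMem]
    tauto
  obtain ⟨y, hxy, hy, hbox⟩ := exists_rel_notMem_of_notMem (x := x)
    (φ := conj φ (impl (box φ) (box (box φ)))) (fun hx => hcon (((hmem x).1 hx).2 h))
  refine hy ((hmem y).2 ⟨hxy φ h, fun hφy => (y.box_mem hL).2 fun z hyz => ?_⟩)
  by_contra hz
  have hz' : conj φ (impl (box φ) (box (box φ))) ∈ z.carrier :=
    (hmem z).2 ⟨hyz φ hφy, fun h => absurd h hz⟩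
  have hzb := (z.impl_mem hL).1 (hyz _ hbox) hz'
  rw [box_mem _ hL] at hzb
  exact hz ((z.box_mem hL).2 fun w hzw => ((hmem w).1 (hzb w hzw)).1)

theorem Rel.trans (hxy : Rel x y) (hyz : Rel y z) : Rel x z :=
  fun _ hφ => hyz _ (hxy _ (box_box_mem hφ))

theorem Rel.total (hxy : Rel x y) (hxz : Rel x z) : Rel y z ∨ Rel z y := by
  have hL := grz3_isNormalLogic
  by_contra! hcon
  obtain ⟨hyz, hzy⟩ := hcon
  simp only [Rel, not_forall] at hyz hzy
  obtain ⟨α, hαy, hαz⟩ := hyz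
  obtain ⟨β, hβz, hβy⟩ := hzy
  have h : disj (box (impl (box α) β)) (box (impl (box β) α)) ∈ Grz3 :=
    grz3_isNormalLogic.subst axPoint3 (fun n => if n = 0 then α else β)
      (subset_generated _ (by simp))
  have hx := x.isTheory.sub h
  simp only [disj, neg, impl_mem _ hL, x.fls_notMem] at hx
  by_cases h₁ : box (impl (box α) β) ∈ x.carrier
  · exact hβy ((y.impl_mem hL).1 (hxy _ h₁) hαy)
  · exact hαz ((z.impl_mem hL).1 (hxz _ (hx h₁)) hβz)

end World

/-- The formulas whose boxes are subformulas of the given one. -/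
def boxArgs : Formula → List Formula
  | .var _ => []
  | .fls => []
  | .impl φ ψ => boxArgs φ ++ boxArgs ψ
  | .box φ => φ :: boxArgs φ

/-- From any world of the canonical model starts a finite chain in which every box from a given
finite list that fails at a member is refuted at a later member. -/
theorem exists_finite_chain (x : World Grz3) (S : List Formula) :
    ∃ (n : ℕ) (c : Fin (n + 1) → World Grz3), c 0 = x ∧
      (∀ i j, i ≤ j → World.Rel (c i) (c j)) ∧
      ∀ ψ ∈ S, ∀ i, box ψ ∉ (c i).carrier → ∃ j, i ≤ j ∧ ψ ∉ (c j).carrier := by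
  classical
  have hL := grz3_isNormalLogic
  have hlast : ∀ ψ, ∃ z, World.Rel x z ∧ (box ψ ∉ x.carrier →
      ψ ∉ z.carrier ∧ box (impl ψ (box ψ)) ∈ z.carrier) := by
    intro ψ
    by_cases h : box ψ ∈ x.carrier
    · exact ⟨x, x.rel_refl, fun h' => absurd h h'⟩
    · rw [World.box_mem _ hL] at h
      push Not at h
      obtain ⟨w, hxw, hw⟩ := h
      obtain ⟨z, hwz, hz⟩ := World.exists_rel_notMem_of_notMem hw
      exact ⟨z, hxw.trans hwz, fun _ => hz⟩
  choose z hxz hz using hlast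
  let r : {w // World.Rel x w} → {w // World.Rel x w} → Prop := fun a b => World.Rel a.1 b.1
  have : Std.Total r := ⟨fun a b => World.Rel.total a.2 b.2⟩
  have : IsTrans _ r := ⟨fun a b c hab hbc => World.Rel.trans hab hbc⟩
  let l := (S.map fun ψ => (⟨z ψ, hxz ψ⟩ : {w // World.Rel x w})).insertionSort r
  have hsorted : (⟨x, x.rel_refl⟩ :: l).Pairwise r :=
    List.pairwise_cons.2 ⟨fun a _ => a.2, List.pairwise_insertionSort r _⟩
  let c : Fin (l.length + 1) → World Grz3 :=
    fun i => ((⟨x, x.rel_refl⟩ :: l : List {w // World.Rel x w}).get i).1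
  have hc : ∀ i j, i ≤ j → World.Rel (c i) (c j) := by
    intro i j hij
    rcases hij.eq_or_lt with rfl | hij
    · exact World.rel_refl _
    · exact List.pairwise_iff_get.1 hsorted i j hij
  refine ⟨l.length, c, rfl, hc, fun ψ hψ i hi => ?_⟩
  have hxψ : box ψ ∉ x.carrier := fun h => hi (hc 0 i (Fin.zero_le i) _ (World.box_box_mem h))
  obtain ⟨k, hk⟩ : ∃ k, c k = z ψ := by
    have hmem : (⟨z ψ, hxz ψ⟩ : {w // World.Rel x w}) ∈ l :=
      (List.mem_insertionSort r).2 (List.mem_map.2 ⟨ψ, hψ, rfl⟩)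
    obtain ⟨k, hk⟩ := List.get_of_mem (List.mem_cons_of_mem ⟨x, x.rel_refl⟩ hmem)
    exact ⟨k, congrArg Subtype.val hk⟩
  obtain ⟨hz₁, hz₂⟩ := hz ψ hxψ
  rw [← hk] at hz₁ hz₂
  rcases le_total i k with h | h
  · exact ⟨k, h, hz₁⟩
  · exact ⟨i, le_rfl, fun hψi => hi (((c i).impl_mem hL).1 (hc k i h _ hz₂) hψi)⟩

end Grz3

section Ratchet

variable {U : Type} (N : KripkeModel U)

theorem satisfies_bigOr (u : U) (l : List Formula) :
    Satisfies N u (bigOr l) ↔ ∃ φ ∈ l, Satisfies N u φ := by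
  induction l with
  | nil => simp [bigOr, Satisfies]
  | cons a l ih =>
    simp only [bigOr, disj, neg, Satisfies, ih, List.exists_mem_cons_iff]
    tauto

theorem satisfies_bigAnd (u : U) (l : List Formula) :
    Satisfies N u (bigAnd l) ↔ ∀ φ ∈ l, Satisfies N u φ := by
  induction l with
  | nil => simp [bigAnd, tru, neg, Satisfies]
  | cons a l ih =>
    simp only [bigAnd, conj, neg, Satisfies, ih, List.forall_mem_cons]
    tauto

theorem satisfies_Theta (u : U) {n : ℕ} (b : Fin n → Formula) (A : Finset (Fin n)) :
    Satisfies N u (Theta b A) ↔ ∀ i, Satisfies N u (box (b i)) ↔ i ∈ A := by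
  simp only [Theta, satisfies_bigAnd, List.forall_mem_map, Finset.mem_toList, Finset.mem_univ,
    forall_true_left]
  refine forall_congr' fun i => ?_
  by_cases h : i ∈ A
  · simp [h]
  · simp [h, neg, Satisfies]

variable {N} {u0 : U} {n : ℕ} {r : Fin (n + 1) → Formula}

/-- The ratchet is cranked exactly up to position `i` at `u`. -/
def RatchetAt (N : KripkeModel U) (r : Fin (n + 1) → Formula) (u : U) (i : Fin (n + 1)) : Prop :=
  ∀ j, Satisfies N u (box (r j)) ↔ j ≤ i

theorem RatchetAt.eq {u : U} {i j : Fin (n + 1)} (hi : RatchetAt N r u i)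
    (hj : RatchetAt N r u j) : i = j :=
  le_antisymm ((hj i).1 ((hi i).2 le_rfl)) ((hi j).1 ((hj j).2 le_rfl))

theorem satisfies_box_of_rel (htrans : Transitive N.rel) {u v : U} (huv : N.rel u v)
    {φ : Formula} (h : Satisfies N u (box φ)) : Satisfies N v (box φ) :=
  fun w hvw => h w (htrans huv hvw)

theorem RatchetAt.le_of_rel (htrans : Transitive N.rel) {u v : U} {i j : Fin (n + 1)}
    (hi : RatchetAt N r u i) (hj : RatchetAt N r v j) (huv : N.rel u v) : i ≤ j :=
  (hj i).1 (satisfies_box_of_rel htrans huv ((hi i).2 le_rfl))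

theorem Ratchet.ratchetAt_zero (hr : Ratchet N u0 r) : RatchetAt N r u0 0 := by
  intro j
  rw [Fin.le_zero_iff]
  refine ⟨fun h => ?_, ?_⟩
  · by_contra hj
    exact (hr.1 j).2 (Fin.pos_iff_ne_zero.2 hj) h
  · rintro rfl
    exact (hr.1 0).1 rfl

theorem Ratchet.exists_ratchetAt (htrans : Transitive N.rel) (hr : Ratchet N u0 r) {u : U}
    (hu : N.rel u0 u) : ∃ i, RatchetAt N r u i := by
  classical
  have h0 : Satisfies N u (box (r 0)) := satisfies_box_of_rel htrans hu ((hr.1 0).1 rfl)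
  obtain ⟨i, hi, hmax⟩ := (Finset.univ.filter fun i => Satisfies N u (box (r i))).exists_max_image
    id ⟨0, by simpa using h0⟩
  simp only [Finset.mem_filter, Finset.mem_univ, true_and, id] at hi hmax
  refine ⟨i, fun j => ⟨hmax j, fun hji => ?_⟩⟩
  rcases hji.eq_or_lt with rfl | hji
  · exact hi
  · exact hr.2.1 u hu j i hji hi

theorem Ratchet.exists_rel_ratchetAt (hrefl : Reflexive N.rel) (htrans : Transitive N.rel)
    (hinit : ∀ u, N.rel u0 u) (hr : Ratchet N u0 r) {u : U} {i j : Fin (n + 1)} (hij : i ≤ j)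
    (hu : RatchetAt N r u i) : ∃ v, N.rel u v ∧ RatchetAt N r v j := by
  induction j using Fin.induction with
  | zero => exact ⟨u, hrefl u, Fin.le_zero_iff.1 hij ▸ hu⟩
  | succ j ih =>
    rcases hij.eq_or_lt with rfl | hij
    · exact ⟨u, hrefl u, hu⟩
    · obtain ⟨v, huv, hv⟩ := ih (Fin.le_castSucc_iff.2 hij)
      obtain ⟨w, hvw, hw⟩ := hr.2.2 v (hinit v) j.succ (Fin.succ_pos j)
        fun k => (hv k).trans Fin.le_castSucc_iff
      exact ⟨w, htrans huv hvw, hw⟩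

/-- The substitution that makes the positions of a ratchet of length `n + 1` simulate the
valuation `V` on the chain `Fin (n + 1)`. -/
noncomputable def ratchetSubst (r : Fin (n + 1) → Formula) (V : ℕ → Fin (n + 1) → Prop)
    (k : ℕ) : Formula :=
  labelFormula (fun i => Theta r (Finset.Iic i)) (V k)

theorem RatchetAt.satisfies_ratchetSubst_iff {u : U} {i : Fin (n + 1)}
    (hu : RatchetAt N r u i) (V : ℕ → Fin (n + 1) → Prop) (k : ℕ) :
    Satisfies N u (ratchetSubst r V k) ↔ V k i := by
  classical
  have hΘ : ∀ j, Satisfies N u (Theta r (Finset.Iic j)) ↔ j = i := by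
    intro j
    rw [satisfies_Theta]
    simp only [Finset.mem_Iic]
    refine ⟨fun h => RatchetAt.eq h hu, ?_⟩
    rintro rfl
    exact hu
  simp [ratchetSubst, labelFormula, satisfies_bigOr, hΘ]

end Ratchet

/-- If u₀ is an initial world of a reflexive transitive Kripke model N that
admits ratchets of every finite length, then every formula valid at u₀ is provable in
Grz.3. -/
theorem statement15 {U : Type} (N : KripkeModel U) (u0 : U)
    (hrefl : Reflexive N.rel) (htrans : Transitive N.rel) (hinit : ∀ u, N.rel u0 u)
    (hr : ∀ n : ℕ, ∃ r : Fin n → Formula, Ratchet N u0 r) :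
    ∀ φ : Formula, (∀ σ : ℕ → Formula, Satisfies N u0 (φ.subst σ)) → φ ∈ Grz3 := by
  have hL := grz3_isNormalLogic
  intro φ hφ
  by_contra hcon
  obtain ⟨x, -, hx⟩ := hL.isTheory.exists_world hL hcon
  obtain ⟨n, c, rfl, hc, hbox⟩ := exists_finite_chain x (boxArgs φ)
  obtain ⟨r, hr⟩ := hr (n + 1)
  have truth : ∀ ψ, boxArgs ψ ⊆ boxArgs φ → ∀ u i, RatchetAt N r u i →
      (Satisfies N u (ψ.subst (ratchetSubst r fun k i => var k ∈ (c i).carrier)) ↔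
        ψ ∈ (c i).carrier) := by
    intro ψ
    induction ψ with
    | var k => exact fun _ u i hu => hu.satisfies_ratchetSubst_iff _ k
    | fls => exact fun _ u i _ => iff_of_false id (c i).fls_notMem
    | impl α β ihα ihβ =>
      intro hS u i hu
      rw [World.impl_mem _ hL, ← ihα (fun _ h => hS (List.mem_append_left _ h)) u i hu,
        ← ihβ (fun _ h => hS (List.mem_append_right _ h)) u i hu]
      rfl
    | box α ih =>
      intro hS u i hu
      have ih := ih fun _ h => hS (List.mem_cons_of_mem _ h)
      constructor
      · intro h
        by_contra hi
        obtain ⟨j, hij, hj⟩ := hbox α (hS List.mem_cons_self) i hi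
        obtain ⟨v, huv, hv⟩ := hr.exists_rel_ratchetAt hrefl htrans hinit hij hu
        exact hj ((ih v j hv).1 (h v huv))
      · intro h v huv
        obtain ⟨j, hj⟩ := hr.exists_ratchetAt htrans (hinit v)
        exact (ih v j hj).2 (hc i j (hu.le_of_rel htrans hj huv) α h)
  exact hx ((truth φ (fun _ h => h) u0 0 hr.ratchetAt_zero).1 (hφ _))

end GrzPaper
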